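/- arXiv:2109.09816 — 2 statements merged into one kernel-verified Lean document; each statement's English description precedes it below -/
import Mathlib

section
/- Regret bound of the ternary policy: for every constant C_ε > 0 there exists a constant C_ter > 0 depending only on C_ε such that, under the sequential ternary-policy model with ε_t = C_ε · w_t in every round, the expected cumulative regret satisfies E[Reg(T)] ≤ C_ter for all horizons T. -/
open MeasureTheory ProbabilityTheory Set

noncomputable section

/-- Standard normal density. -/
def stdPdf (z : ℝ) : ℝ := Real.exp (-z ^ 2 / 2) / Real.sqrt (2 * Real.pi)

/-- Standard normal cdf. -/
def stdCdf (c : ℝ) : ℝ := ∫ z in Set.Iio c, stdPdf z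

/-- Mean of a standard normal truncated to `(c, ∞)`. -/
def truncMeanAbove (c : ℝ) : ℝ :=
  (∫ z in Set.Ioi c, z * stdPdf z) / (∫ z in Set.Ioi c, stdPdf z)

/-- Mean of a standard normal truncated to `(-∞, c)`. -/
def truncMeanBelow (c : ℝ) : ℝ :=
  (∫ z in Set.Iio c, z * stdPdf z) / (∫ z in Set.Iio c, stdPdf z)

/-- Mean of a standard normal truncated to `(a, b)`. -/
def truncMeanBetween (a b : ℝ) : ℝ :=
  (∫ z in Set.Ioo a b, z * stdPdf z) / (∫ z in Set.Ioo a b, stdPdf z)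

/-- Signum, with the (measure-zero) value at `0` set to `-1`. -/
def sgn (x : ℝ) : ℝ := if 0 < x then 1 else -1

/-- The standard normal measure on `ℝ`. -/
def stdNormal : Measure ℝ := gaussianReal 0 1

/-- The joint law of two independent standard normals. -/
def stdNormal2 : Measure (ℝ × ℝ) := stdNormal.prod stdNormal

/-- Uniform measure on `[-1, 1]` (the prior on the state θ). -/
def uniformState : Measure ℝ := (2 : ENNReal)⁻¹ • volume.restrict (Set.Icc (-1 : ℝ) 1)

instance : IsProbabilityMeasure stdNormal := by unfold stdNormal; infer_instance
instance : IsProbabilityMeasure stdNormal2 := by unfold stdNormal2; infer_instance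
/-- The superior arm. -/
def bStar (θ x z : ℝ) : ℝ := if 0 < x * θ + z then 1 else -1

/-- Recommender's message under the ternary policy with tolerance `ε`. -/
def aTer (m ε x z : ℝ) : ℝ :=
  if ε < x * m + z then 1 else if |x * m + z| < ε then 0 else -1

/-- User's posterior mean of the dynamic payoff under the ternary policy. -/
def ZTer (m ε x z : ℝ) : ℝ :=
  if ε < x * m + z then truncMeanAbove (-(x * m) + ε)
  else if |x * m + z| < ε then truncMeanBetween (-(x * m) - ε) (-(x * m) + ε)
  else truncMeanBelow (-(x * m) - ε)

/-- User's action under the ternary policy. -/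
def bTer (θ m ε x z : ℝ) : ℝ := if 0 < x * θ + ZTer m ε x z then 1 else -1

/-- Per-round regret under the ternary policy. -/
def regTer (θ m ε x z : ℝ) : ℝ := if bTer θ m ε x z = bStar θ x z then 0 else |x * θ + z|

/-- One-step update of the confidence interval under the ternary policy with
tolerance `ε = Cε * (u - l)`. -/
def updTer (θ Cε l u x z : ℝ) : ℝ × ℝ :=
  if bTer θ ((l + u) / 2) (Cε * (u - l)) x z * sgn x < 0 then
    (l, min u (-(ZTer ((l + u) / 2) (Cε * (u - l)) x z / x)))
  else
    (max l (-(ZTer ((l + u) / 2) (Cε * (u - l)) x z / x)), u)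

/-- Confidence interval `(l_t, u_t)` of the recommender under the ternary
policy with `ε_t = Cε * w_t`, starting from `(-1, 1)`. -/
def terLU (Cε θ : ℝ) (ω : ℕ → ℝ × ℝ) : ℕ → ℝ × ℝ
  | 0 => (-1, 1)
  | t + 1 => updTer θ Cε (terLU Cε θ ω t).1 (terLU Cε θ ω t).2 (ω t).1 (ω t).2

/-- Cumulative regret over `T` rounds under the ternary policy. -/
def terCumReg (Cε θ : ℝ) (ω : ℕ → ℝ × ℝ) (T : ℕ) : ℝ :=
  ∑ t ∈ Finset.range T,
    regTer θ (((terLU Cε θ ω t).1 + (terLU Cε θ ω t).2) / 2)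
      (Cε * ((terLU Cε θ ω t).2 - (terLU Cε θ ω t).1)) (ω t).1 (ω t).2

lemma stdPdf_pos (z : ℝ) : 0 < stdPdf z := by
  unfold stdPdf
  positivity

lemma stdPdf_neg (z : ℝ) : stdPdf (-z) = stdPdf z := by
  simp [stdPdf]

lemma stdPdf_le_one (z : ℝ) : stdPdf z ≤ 1 := by
  have h1 : Real.exp (-z ^ 2 / 2) ≤ 1 := Real.exp_le_one_iff.2 (by nlinarith [sq_nonneg z])
  have h2 : 1 ≤ Real.sqrt (2 * Real.pi) :=
    Real.one_le_sqrt.2 (by linarith [Real.pi_gt_three])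
  exact (div_le_one (by linarith)).2 (h1.trans h2)

lemma stdPdf_anti_abs {y z : ℝ} (h : |y| ≤ |z|) : stdPdf z ≤ stdPdf y := by
  unfold stdPdf
  have := sq_le_sq.2 h
  gcongr

lemma gaussianPDFReal_eq_stdPdf (z : ℝ) : gaussianPDFReal 0 1 z = stdPdf z := by
  simp [gaussianPDFReal, stdPdf, div_eq_inv_mul]

lemma hasDerivAt_stdPdf (z : ℝ) : HasDerivAt stdPdf (-z * stdPdf z) z := by
  have h : HasDerivAt (fun z : ℝ => -z ^ 2 / 2) (-z) z := by
    convert! ((hasDerivAt_pow 2 z).neg.div_const 2) using 1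
    simp only [Nat.cast_ofNat, Nat.add_one_sub_one, pow_one]
    ring
  convert! h.exp.div_const (Real.sqrt (2 * Real.pi)) using 1
  unfold stdPdf
  ring

lemma integrable_pow_mul_stdPdf (n : ℕ) : Integrable fun z : ℝ => z ^ n * stdPdf z := by
  have h := (integrable_rpow_mul_exp_neg_mul_sq (b := 1 / 2) (by norm_num) (s := n)
    (by linarith [(Nat.cast_nonneg n : (0 : ℝ) ≤ n)])).div_const (Real.sqrt (2 * Real.pi))
  refine h.congr (ae_of_all _ fun z => ?_)
  simp only [Real.rpow_natCast, stdPdf]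
  rw [show -(1 / 2) * z ^ 2 = -z ^ 2 / 2 by ring]
  ring

lemma integrable_stdPdf : Integrable stdPdf := by
  simpa using integrable_pow_mul_stdPdf 0

lemma integrable_id_mul_stdPdf : Integrable fun z : ℝ => z * stdPdf z := by
  simpa using integrable_pow_mul_stdPdf 1

lemma setIntegral_stdPdf_pos {s : Set ℝ} (hs : 0 < volume s) :
    0 < ∫ z in s, stdPdf z := by
  rw [integral_pos_iff_support_of_nonneg (fun z => (stdPdf_pos z).le) integrable_stdPdf.integrableOn]
  have : Function.support stdPdf = univ := by
    ext z
    simpa using (stdPdf_pos z).ne'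
  simpa [this] using hs

/-- A quantitative lower bound for the gap between the upper truncated mean and its threshold. -/
lemma add_le_truncMeanAbove (c : ℝ) : c + 1 / (6 * (1 + |c|)) ≤ truncMeanAbove c := by
  set r : ℝ := 1 / (1 + |c|) with hr
  have hc0 : 0 ≤ |c| := abs_nonneg c
  have hr0 : 0 < r := by positivity
  have hr1 : r ≤ 1 := by rw [hr, div_le_one (by positivity)]; linarith
  have hrc : |r * c| ≤ 1 := by
    rw [abs_mul, abs_of_pos hr0, hr, div_mul_eq_mul_div, div_le_one (by positivity)]
    linarith
  obtain ⟨hrc1, hrc2⟩ := abs_le.1 hrc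
  set Q := ∫ z in Ioi c, stdPdf z with hQ
  set N := ∫ z in Ioi c, z * stdPdf z with hN
  have hQ0 : 0 < Q := setIntegral_stdPdf_pos (by simp)
  have i0 := integrable_stdPdf
  have i1 := integrable_id_mul_stdPdf
  have i2 := integrable_pow_mul_stdPdf 2
  have i3 := integrable_pow_mul_stdPdf 3
  set a : ℝ := -2 * r - c * r ^ 2 with ha
  -- the antiderivative is chosen so that only the zeroth and first moments remain
  set F : ℝ → ℝ := fun z => -(a * (z - c) + r ^ 2 * (z - c) ^ 2) * stdPdf z with hF
  set F' : ℝ → ℝ := fun z => (z * (a * (z - c) + r ^ 2 * (z - c) ^ 2)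
    - (a + 2 * r ^ 2 * (z - c))) * stdPdf z with hF'
  have hderiv : ∀ z, HasDerivAt F (F' z) z := by
    intro z
    have h1 : HasDerivAt (fun z : ℝ => z - c) 1 z := (hasDerivAt_id z).sub_const c
    have h2 := (((h1.const_mul a).add ((h1.pow 2).const_mul (r ^ 2))).neg).mul
      (hasDerivAt_stdPdf z)
    convert! h2 using 1
    simp only [hF', Pi.neg_apply, Pi.add_apply, Pi.pow_apply]
    push_cast
    ring
  have hFi : Integrable F := by
    refine (((i2.const_mul (-r ^ 2)).add (i1.const_mul (2 * r ^ 2 * c - a))).add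
      (i0.const_mul (a * c - r ^ 2 * c ^ 2))).congr (ae_of_all _ fun z => ?_)
    simp only [hF, Pi.add_apply]
    ring
  have hFi' : Integrable F' := by
    refine ((((i3.const_mul (r ^ 2)).add (i2.const_mul (a - 2 * r ^ 2 * c))).add
      (i1.const_mul (r ^ 2 * c ^ 2 - a * c - 2 * r ^ 2))).add
      (i0.const_mul (2 * r ^ 2 * c - a))).congr (ae_of_all _ fun z => ?_)
    simp only [hF', Pi.add_apply]
    ring
  have hlim := tendsto_zero_of_hasDerivAt_of_integrableOn_Ioi (a := c) (fun z _ => hderiv z)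
    hFi'.integrableOn hFi.integrableOn
  have hint := integral_Ioi_of_hasDerivAt_of_tendsto' (a := c) (fun z _ => hderiv z)
    hFi'.integrableOn hlim
  have hFc : F c = 0 := by simp [hF]
  rw [hFc, sub_zero] at hint
  set b : ℝ := (1 + r * c) ^ 2 + 2 * r ^ 2 with hb
  have hpos : 0 ≤ ∫ z in Ioi c, (F' z + (b * (z * stdPdf z) + (a - b * c) * stdPdf z)) := by
    refine setIntegral_nonneg measurableSet_Ioi fun z hz => ?_
    have : F' z + (b * (z * stdPdf z) + (a - b * c) * stdPdf z)
        = (z - c) * (1 - r * (z - c)) ^ 2 * stdPdf z := by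
      simp only [hF', ha, hb]
      ring
    rw [this]
    have h1 := stdPdf_pos z
    have h2 : 0 ≤ z - c := sub_nonneg.2 (le_of_lt hz)
    positivity
  have hi : Integrable fun z : ℝ => b * (z * stdPdf z) + (a - b * c) * stdPdf z :=
    (i1.const_mul b).add (i0.const_mul (a - b * c))
  rw [integral_add hFi'.integrableOn hi.integrableOn, hint,
    integral_add (i1.const_mul b).integrableOn (i0.const_mul (a - b * c)).integrableOn,
    integral_const_mul, integral_const_mul, ← hN, ← hQ, zero_add] at hpos
  have hb0 : 0 < b := by positivity
  have hb6 : b ≤ 6 := by nlinarith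
  have ha' : a ≤ -r := by nlinarith
  have key : r * Q ≤ 6 * (N - c * Q) := by
    have h1 : r * Q ≤ b * (N - c * Q) := by nlinarith
    have h2 : 0 ≤ N - c * Q := by
      by_contra h
      push Not at h
      nlinarith [mul_pos hr0 hQ0]
    nlinarith
  have : c + 1 / (6 * (1 + |c|)) = c + r / 6 := by
    rw [hr]; field_simp
  rw [this, truncMeanAbove, ← hQ, ← hN, le_div_iff₀ hQ0]
  linarith

lemma truncMeanBelow_eq_neg (c : ℝ) : truncMeanBelow c = -truncMeanAbove (-c) := by
  have h1 := integral_comp_neg_Iic c stdPdf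
  have h2 := integral_comp_neg_Iic c fun z => z * stdPdf z
  simp only [stdPdf_neg, neg_mul, integral_neg, integral_Iic_eq_integral_Iio] at h1 h2
  rw [truncMeanBelow, truncMeanAbove, ← h1, ← h2, neg_div, neg_neg]

lemma truncMeanBelow_le_sub (c : ℝ) : truncMeanBelow c ≤ c - 1 / (6 * (1 + |c|)) := by
  have := add_le_truncMeanAbove (-c)
  rw [abs_neg] at this
  rw [truncMeanBelow_eq_neg]
  linarith

lemma truncMeanBetween_mem {a b : ℝ} (h : a < b) :
    a ≤ truncMeanBetween a b ∧ truncMeanBetween a b ≤ b := by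
  have hQ : 0 < ∫ z in Ioo a b, stdPdf z := setIntegral_stdPdf_pos (by simpa using h)
  have i1 := integrable_id_mul_stdPdf.integrableOn (s := Ioo a b)
  have i0 := integrable_stdPdf
  rw [truncMeanBetween, le_div_iff₀ hQ, div_le_iff₀ hQ, ← integral_const_mul,
    ← integral_const_mul]
  exact ⟨setIntegral_mono_on (i0.const_mul a).integrableOn i1 measurableSet_Ioo
      fun z hz => mul_le_mul_of_nonneg_right hz.1.le (stdPdf_pos z).le,
    setIntegral_mono_on i1 (i0.const_mul b).integrableOn measurableSet_Ioo
      fun z hz => mul_le_mul_of_nonneg_right hz.2.le (stdPdf_pos z).le⟩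

/-- The confidence interval shrinks and keeps containing the state. -/
lemma updTer_bounds {θ Cε l u x : ℝ} (z : ℝ) (hl : l ≤ θ) (hu : θ ≤ u) (hx : x ≠ 0) :
    l ≤ (updTer θ Cε l u x z).1 ∧ (updTer θ Cε l u x z).1 ≤ θ ∧
      θ ≤ (updTer θ Cε l u x z).2 ∧ (updTer θ Cε l u x z).2 ≤ u := by
  unfold updTer bTer sgn
  set Z := ZTer ((l + u) / 2) (Cε * (u - l)) x z
  rcases lt_or_gt_of_ne hx with h | h
  · by_cases hb : 0 < x * θ + Z
    · have : θ ≤ -(Z / x) := by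
        rw [← neg_div, le_div_iff_of_neg h]; linarith
      simp [hb, h.not_gt, hl, hu, this]
    · have : -(Z / x) ≤ θ := by
        rw [← neg_div, div_le_iff_of_neg h]; linarith
      simp [hb, h.not_gt, hl, hu, this, not_lt.2 zero_le_one]
  · by_cases hb : 0 < x * θ + Z
    · have : -(Z / x) ≤ θ := by
        rw [← neg_div, div_le_iff₀ h]; linarith
      simp [hb, h, hl, hu, this, not_lt.2 zero_le_one]
    · have : θ ≤ -(Z / x) := by
        rw [← neg_div, le_div_iff₀ h]; linarith
      simp [hb, h, hl, hu, this]

/-- A neutral message with a sufficiently informative context shrinks the interval by a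
constant factor, whatever the user does. -/
lemma updTer_width_le {θ Cε l u x z : ℝ} (hC : 0 < Cε) (hx : 4 * Cε ≤ x)
    (hz : |x * ((l + u) / 2) + z| < Cε * (u - l)) :
    (updTer θ Cε l u x z).2 - (updTer θ Cε l u x z).1 ≤ 3 / 4 * (u - l) := by
  have hε : 0 < Cε * (u - l) := (abs_nonneg _).trans_lt hz
  have hw : 0 < u - l := pos_of_mul_pos_right hε hC.le
  have hx0 : 0 < x := by linarith
  have hZ : ZTer ((l + u) / 2) (Cε * (u - l)) x z = truncMeanBetween
      (-(x * ((l + u) / 2)) - Cε * (u - l)) (-(x * ((l + u) / 2)) + Cε * (u - l)) := by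
    rw [ZTer, if_neg (not_lt.2 ((le_abs_self _).trans hz.le)), if_pos hz]
  obtain ⟨h1, h2⟩ := truncMeanBetween_mem
    (show -(x * ((l + u) / 2)) - Cε * (u - l) < -(x * ((l + u) / 2)) + Cε * (u - l) by linarith)
  rw [← hZ] at h1 h2
  unfold updTer
  set Z := ZTer ((l + u) / 2) (Cε * (u - l)) x z
  have h3 : Cε * (u - l) ≤ x * ((u - l) / 4) := by nlinarith
  have hp1 : -(Z / x) ≤ (l + u) / 2 + (u - l) / 4 := by
    rw [← neg_div, div_le_iff₀ hx0]; linarith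
  have hp2 : (l + u) / 2 - (u - l) / 4 ≤ -(Z / x) := by
    rw [← neg_div, le_div_iff₀ hx0]; linarith
  split_ifs
  · have := min_le_right u (-(Z / x))
    simp only
    linarith
  · have := le_max_right l (-(Z / x))
    simp only
    linarith

lemma bTer_eq_or (θ m ε x z : ℝ) : bTer θ m ε x z = 1 ∧ 0 < x * θ + ZTer m ε x z ∨
    bTer θ m ε x z = -1 ∧ x * θ + ZTer m ε x z ≤ 0 := by
  unfold bTer
  split_ifs with h
  · exact Or.inl ⟨rfl, h⟩
  · exact Or.inr ⟨rfl, not_lt.1 h⟩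

lemma bStar_eq_or (θ x z : ℝ) : bStar θ x z = 1 ∧ 0 < x * θ + z ∨
    bStar θ x z = -1 ∧ x * θ + z ≤ 0 := by
  unfold bStar
  split_ifs with h
  · exact Or.inl ⟨rfl, h⟩
  · exact Or.inr ⟨rfl, not_lt.1 h⟩

lemma regTer_nonneg (θ m ε x z : ℝ) : 0 ≤ regTer θ m ε x z := by
  unfold regTer
  split_ifs <;> positivity

/-- A positive regret forces either a nearly balanced payoff or an exceptionally large context. -/
lemma regTer_cases {θ Cε m w x z : ℝ} (hC : 0 < Cε) (hw0 : 0 ≤ w) (hw2 : w ≤ 2)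
    (hm : |m| ≤ 1) (hθ : |θ - m| ≤ w) :
    regTer θ m (Cε * w) x z = 0 ∨
      (|x * m + z| ≤ w * (|x| + Cε) ∧ |x * θ + z| ≤ 2 * (w * (|x| + Cε))) ∨
      1 ≤ w * (6 * (1 + 2 * Cε) * (1 + |x|) ^ 2) := by
  have hx0 := abs_nonneg x
  have hε : 0 ≤ Cε * w := by positivity
  have hxw : 0 ≤ |x| * w := by positivity
  have hxm : |x * m| ≤ |x| := by
    rw [abs_mul]; nlinarith
  have hxθ : |x * (θ - m)| ≤ |x| * w := by
    rw [abs_mul]; gcongr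
  have hd : x * (θ - m) = x * θ - x * m := by ring
  rw [hd] at hxθ
  obtain ⟨hd1, hd2⟩ := abs_le.1 hxθ
  have near : |x * m + z| ≤ w * (|x| + Cε) →
      |x * m + z| ≤ w * (|x| + Cε) ∧ |x * θ + z| ≤ 2 * (w * (|x| + Cε)) := by
    intro h
    refine ⟨h, ?_⟩
    have h1 : x * θ + z = (x * θ - x * m) + (x * m + z) := by ring
    have := abs_add_le (x * θ - x * m) (x * m + z)
    rw [h1]
    nlinarith
  have far : ∀ c : ℝ, |c| ≤ |x| + Cε * w → 1 / (6 * (1 + |c|)) ≤ |x| * w →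
      1 ≤ w * (6 * (1 + 2 * Cε) * (1 + |x|) ^ 2) := by
    intro c hc h
    have hc0 := abs_nonneg c
    rw [div_le_iff₀ (by positivity)] at h
    have h1 : 1 + |c| ≤ (1 + 2 * Cε) * (1 + |x|) := by nlinarith
    have h2 : |x| * (6 * (1 + |c|)) ≤ (1 + |x|) * (6 * ((1 + 2 * Cε) * (1 + |x|))) := by
      gcongr
      linarith
    nlinarith
  by_cases h0 : |x * m + z| ≤ Cε * w
  · exact Or.inr (Or.inl (near (by nlinarith)))
  by_cases hreg : bTer θ m (Cε * w) x z = bStar θ x z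
  · left; simp [regTer, hreg]
  right
  rw [not_le, lt_abs] at h0
  rcases h0 with h0 | h0
  · have hZ : ZTer m (Cε * w) x z = truncMeanAbove (-(x * m) + Cε * w) := by
      rw [ZTer, if_pos h0]
    rcases bTer_eq_or θ m (Cε * w) x z with ⟨hb, hb'⟩ | ⟨hb, hb'⟩ <;>
    rcases bStar_eq_or θ x z with ⟨hs, hs'⟩ | ⟨hs, hs'⟩
    · exact absurd (hb.trans hs.symm) hreg
    · refine Or.inl (near (abs_le.2 ⟨?_, ?_⟩)) <;> linarith
    · refine Or.inr (far (-(x * m) + Cε * w) ?_ ?_)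
      · refine (abs_add_le _ _).trans ?_
        rw [abs_neg, abs_of_nonneg hε]
        linarith
      · have := add_le_truncMeanAbove (-(x * m) + Cε * w)
        rw [hZ] at hb'
        linarith
    · exact absurd (hb.trans hs.symm) hreg
  · have hZ : ZTer m (Cε * w) x z = truncMeanBelow (-(x * m) - Cε * w) := by
      rw [ZTer, if_neg (by linarith), if_neg]
      rw [not_lt, le_abs]
      right; linarith
    rcases bTer_eq_or θ m (Cε * w) x z with ⟨hb, hb'⟩ | ⟨hb, hb'⟩ <;>
    rcases bStar_eq_or θ x z with ⟨hs, hs'⟩ | ⟨hs, hs'⟩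
    · exact absurd (hb.trans hs.symm) hreg
    · refine Or.inr (far (-(x * m) - Cε * w) ?_ ?_)
      · refine (abs_sub _ _).trans ?_
        rw [abs_neg, abs_of_nonneg hε]
        linarith
      · have := truncMeanBelow_le_sub (-(x * m) - Cε * w)
        rw [hZ] at hb'
        linarith
    · refine Or.inl (near (abs_le.2 ⟨?_, ?_⟩)) <;> linarith
    · exact absurd (hb.trans hs.symm) hreg

lemma integrable_one_add_abs_pow (n : ℕ) :
    Integrable (fun x : ℝ => (1 + |x|) ^ n) stdNormal := by
  have hid : MemLp id n stdNormal := memLp_id_gaussianReal' n (ENNReal.natCast_ne_top n)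
  have habs : MemLp (fun x : ℝ => |x|) n stdNormal := hid.norm
  have hone : MemLp (fun _ : ℝ => (1 : ℝ)) n stdNormal := memLp_const 1
  have h : MemLp (fun x : ℝ => 1 + |x|) n stdNormal := hone.add habs
  have hnorm : ∀ x : ℝ, ‖1 + |x|‖ = 1 + |x| := fun x => Real.norm_of_nonneg (by positivity)
  have hpow := h.integrable_norm_pow'
  simp only [hnorm] at hpow
  exact hpow

lemma stdNormal_apply (s : Set ℝ) : stdNormal s = ∫⁻ z in s, ENNReal.ofReal (stdPdf z) := by
  rw [stdNormal, gaussianReal_apply _ one_ne_zero]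
  simp [gaussianPDF, gaussianPDFReal_eq_stdPdf]

lemma stdNormal_le_volume (s : Set ℝ) : stdNormal s ≤ volume s := by
  rw [stdNormal_apply]
  calc ∫⁻ z in s, ENNReal.ofReal (stdPdf z) ≤ ∫⁻ _ in s, 1 :=
        lintegral_mono fun z => ENNReal.ofReal_le_one.2 (stdPdf_le_one z)
    _ = volume s := by simp

lemma ofReal_stdPdf_mul_le_stdNormal {s : Set ℝ} (hs : MeasurableSet s) {M : ℝ}
    (hM : ∀ z ∈ s, |z| ≤ |M|) : ENNReal.ofReal (stdPdf M) * volume s ≤ stdNormal s := by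
  rw [stdNormal_apply, ← setLIntegral_const]
  exact setLIntegral_mono' hs fun z hz => ENNReal.ofReal_le_ofReal (stdPdf_anti_abs (hM z hz))

lemma ae_fst_ne_zero : ∀ᵐ p ∂stdNormal2, p.1 ≠ 0 := by
  have h : ∀ᵐ x ∂stdNormal, x ≠ (0 : ℝ) := by
    rw [ae_iff]
    simpa using le_antisymm ((stdNormal_le_volume {0}).trans (by simp)) bot_le
  exact Measure.quasiMeasurePreserving_fst.ae h

/-- The contexts and payoffs for which the interval is guaranteed to shrink. -/
def shrinkSet (Cε m w : ℝ) : Set (ℝ × ℝ) :=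
  {p | p.1 ∈ Icc (4 * Cε) (4 * Cε + 1) ∧ |p.1 * m + p.2| < Cε * w}

lemma measurableSet_shrinkSet (Cε m w : ℝ) : MeasurableSet (shrinkSet Cε m w) := by
  refine (measurable_fst measurableSet_Icc).inter ?_
  have h : Measurable fun p : ℝ × ℝ => |p.1 * m + p.2| := by fun_prop
  exact measurableSet_lt h measurable_const

lemma exists_le_measure_shrinkSet {Cε : ℝ} (hC : 0 < Cε) :
    ∃ κ : ℝ, 0 < κ ∧ ∀ m w : ℝ, |m| ≤ 1 → 0 ≤ w → w ≤ 2 →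
      ENNReal.ofReal (κ * w) ≤ stdNormal2 (shrinkSet Cε m w) := by
  set I := Icc (4 * Cε) (4 * Cε + 1) with hI
  set δ := stdPdf (6 * Cε + 1) with hδ
  have hδ0 : 0 < δ := stdPdf_pos _
  have hq : 0 < stdNormal.real I := by
    refine ENNReal.toReal_pos (ne_of_gt ?_) (measure_ne_top _ _)
    refine lt_of_lt_of_le ?_ (ofReal_stdPdf_mul_le_stdNormal (M := 4 * Cε + 1)
      measurableSet_Icc fun z hz => ?_)
    · simp [stdPdf_pos]
    · rw [abs_of_nonneg (by linarith [hz.1]), abs_of_nonneg (by linarith)]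
      exact hz.2
  refine ⟨δ * (2 * Cε) * stdNormal.real I, by positivity, fun m w hm hw0 hw2 => ?_⟩
  rw [stdNormal2, Measure.prod_apply (measurableSet_shrinkSet _ _ _)]
  calc ENNReal.ofReal (δ * (2 * Cε) * stdNormal.real I * w)
      = ENNReal.ofReal (δ * (2 * Cε * w)) * stdNormal I := by
        rw [← ofReal_measureReal, ← ENNReal.ofReal_mul (by positivity)]
        congr 1
        ring
    _ = ∫⁻ x, I.indicator (fun _ => ENNReal.ofReal (δ * (2 * Cε * w))) x ∂stdNormal := by
        rw [lintegral_indicator_const measurableSet_Icc]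
    _ ≤ ∫⁻ x, stdNormal (Prod.mk x ⁻¹' shrinkSet Cε m w) ∂stdNormal := by
        refine lintegral_mono fun x => indicator_apply_le' (fun hx => ?_) fun _ => zero_le
        have hpre : Prod.mk x ⁻¹' shrinkSet Cε m w =
            Ioo (-(x * m) - Cε * w) (-(x * m) + Cε * w) := by
          ext z
          simp only [shrinkSet, mem_preimage, mem_ofPred_eq, mem_Ioo, abs_lt]
          constructor
          · rintro ⟨-, h1, h2⟩
            constructor <;> linarith
          · rintro ⟨h1, h2⟩
            exact ⟨hx, by linarith, by linarith⟩
        have hxm : |x * m| ≤ 4 * Cε + 1 := by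
          rw [abs_mul, abs_of_nonneg (by linarith [hx.1] : (0 : ℝ) ≤ x)]
          nlinarith [hx.1, hx.2]
        obtain ⟨h1, h2⟩ := abs_le.1 hxm
        rw [hpre]
        refine le_trans (le_of_eq ?_) (ofReal_stdPdf_mul_le_stdNormal (M := 6 * Cε + 1)
          measurableSet_Ioo fun z hz => ?_)
        · rw [Real.volume_Ioo, ← ENNReal.ofReal_mul hδ0.le]
          congr 1
          ring
        · rw [abs_of_nonneg (by linarith : (0 : ℝ) ≤ 6 * Cε + 1), abs_le]
          constructor <;> nlinarith [hz.1, hz.2]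

lemma ofReal_regTer_le {θ Cε m w : ℝ} (hC : 0 < Cε) (hw0 : 0 ≤ w) (hw2 : w ≤ 2)
    (hm : |m| ≤ 1) (hθ : |θ - m| ≤ w) (hθ1 : |θ| ≤ 1) (x z : ℝ) :
    ENNReal.ofReal (regTer θ m (Cε * w) x z) ≤
      (Icc (-(x * m) - w * (|x| + Cε)) (-(x * m) + w * (|x| + Cε))).indicator
        (fun _ => ENNReal.ofReal (2 * (w * (|x| + Cε)))) z +
      ENNReal.ofReal (w ^ 2 * (6 * (1 + 2 * Cε)) ^ 2 * (1 + |x|) ^ 5) *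
        ENNReal.ofReal ((1 + |z|) ^ 1) := by
  have hle : regTer θ m (Cε * w) x z ≤ |x * θ + z| := by
    unfold regTer
    split_ifs
    · positivity
    · exact le_rfl
  rcases regTer_cases (x := x) (z := z) hC hw0 hw2 hm hθ with h | ⟨h1, h2⟩ | h
  · simp [h]
  · refine le_add_of_le_of_nonneg ?_ zero_le
    rw [indicator_of_mem]
    · exact ENNReal.ofReal_le_ofReal (hle.trans h2)
    · obtain ⟨h3, h4⟩ := abs_le.1 h1
      constructor <;> linarith
  · refine le_add_of_nonneg_of_le zero_le ?_
    rw [← ENNReal.ofReal_mul (by positivity)]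
    refine ENNReal.ofReal_le_ofReal ?_
    have h1 : |x * θ + z| ≤ (1 + |x|) * (1 + |z|) := by
      refine (abs_add_le _ _).trans ?_
      rw [abs_mul]
      nlinarith [abs_nonneg x, abs_nonneg z, mul_nonneg (abs_nonneg x) (abs_nonneg z)]
    calc regTer θ m (Cε * w) x z ≤ 1 ^ 2 * ((1 + |x|) * (1 + |z|)) := by
          simpa using hle.trans h1
      _ ≤ (w * (6 * (1 + 2 * Cε) * (1 + |x|) ^ 2)) ^ 2 * ((1 + |x|) * (1 + |z|)) := by
          gcongr
      _ = _ := by ring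

/-- The conditional expected regret of a round is quadratic in the interval width. -/
lemma exists_lintegral_regTer_le {Cε : ℝ} (hC : 0 < Cε) :
    ∃ K : ℝ, 0 < K ∧ ∀ θ m w : ℝ, 0 ≤ w → w ≤ 2 → |m| ≤ 1 → |θ - m| ≤ w → |θ| ≤ 1 →
      ∫⁻ p, ENNReal.ofReal (regTer θ m (Cε * w) p.1 p.2) ∂stdNormal2 ≤
        ENNReal.ofReal (K * w ^ 2) := by
  set M : ℕ → ℝ := fun n => ∫ x, (1 + |x|) ^ n ∂stdNormal with hM
  have hlM : ∀ n, ∫⁻ x, ENNReal.ofReal ((1 + |x|) ^ n) ∂stdNormal = ENNReal.ofReal (M n) :=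
    fun n => (ofReal_integral_eq_lintegral_ofReal (integrable_one_add_abs_pow n)
      (ae_of_all _ fun x => by positivity)).symm
  have hM1 : ∀ n, 1 ≤ M n := by
    intro n
    have : ∫ _ : ℝ, (1 : ℝ) ∂stdNormal ≤ M n :=
      integral_mono (integrable_const 1) (integrable_one_add_abs_pow n) fun x =>
        one_le_pow₀ (by linarith [abs_nonneg x])
    simpa using this
  have hM1' := hM1 1
  have hM5' := hM1 5
  set L : ℝ := 4 * (1 + Cε) ^ 2 + (6 * (1 + 2 * Cε)) ^ 2 * M 1 with hL
  have hL0 : 0 < L := by positivity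
  refine ⟨L * M 5, by positivity, fun θ m w hw0 hw2 hm hθ hθ1 => ?_⟩
  refine (lintegral_prod_le _).trans ?_
  calc ∫⁻ x, ∫⁻ z, ENNReal.ofReal (regTer θ m (Cε * w) x z) ∂stdNormal ∂stdNormal
      ≤ ∫⁻ x, ENNReal.ofReal (w ^ 2 * L) * ENNReal.ofReal ((1 + |x|) ^ 5) ∂stdNormal := by
        refine lintegral_mono fun x => ?_
        refine (lintegral_mono fun z =>
          ofReal_regTer_le hC hw0 hw2 hm hθ hθ1 x z).trans ?_
        rw [lintegral_add_left (measurable_const.indicator measurableSet_Icc),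
          lintegral_indicator_const measurableSet_Icc, lintegral_const_mul' _ _ (by simp), hlM]
        set r := w * (|x| + Cε) with hr
        have hr0 : 0 ≤ r := by positivity
        have hvol := stdNormal_le_volume (Icc (-(x * m) - r) (-(x * m) + r))
        rw [Real.volume_Icc] at hvol
        grw [hvol]
        rw [← ENNReal.ofReal_mul (by positivity), ← ENNReal.ofReal_mul (by positivity),
          ← ENNReal.ofReal_mul (by positivity), ← ENNReal.ofReal_add (by nlinarith) (by positivity)]
        refine ENNReal.ofReal_le_ofReal ?_
        have hx0 := abs_nonneg x
        have h1 : r ≤ w * ((1 + Cε) * (1 + |x|)) := by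
          rw [hr]; gcongr; nlinarith
        have h2 : r ^ 2 ≤ w ^ 2 * (1 + Cε) ^ 2 * (1 + |x|) ^ 5 := by
          calc r ^ 2 ≤ (w * ((1 + Cε) * (1 + |x|))) ^ 2 := by gcongr
            _ = w ^ 2 * (1 + Cε) ^ 2 * (1 + |x|) ^ 2 := by ring
            _ ≤ w ^ 2 * (1 + Cε) ^ 2 * (1 + |x|) ^ 5 := by
              gcongr
              · linarith
              · norm_num
        rw [hL]
        linarith
    _ = ENNReal.ofReal (L * M 5 * w ^ 2) := by
        rw [lintegral_const_mul' _ _ (by simp), hlM, ← ENNReal.ofReal_mul (by positivity)]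
        congr 1
        ring

/-- The regret accumulated over `T` rounds when the interval starts at `s`. -/
def regSum (Cε θ : ℝ) : ℕ → ℝ × ℝ → (ℕ → ℝ × ℝ) → ℝ
  | 0, _, _ => 0
  | T + 1, s, ω =>
    regTer θ ((s.1 + s.2) / 2) (Cε * (s.2 - s.1)) (ω 0).1 (ω 0).2 +
      regSum Cε θ T (updTer θ Cε s.1 s.2 (ω 0).1 (ω 0).2) fun t => ω (t + 1)

lemma regSum_nonneg (Cε θ : ℝ) (T : ℕ) (s : ℝ × ℝ) (ω : ℕ → ℝ × ℝ) :
    0 ≤ regSum Cε θ T s ω := by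
  induction T generalizing s ω with
  | zero => exact le_rfl
  | succ T ih => exact add_nonneg (regTer_nonneg _ _ _ _ _) (ih _ _)

lemma sum_regTer_eq_regSum (Cε θ : ℝ) (ω : ℕ → ℝ × ℝ) (T n : ℕ) :
    ∑ t ∈ Finset.range T,
      regTer θ (((terLU Cε θ ω (n + t)).1 + (terLU Cε θ ω (n + t)).2) / 2)
        (Cε * ((terLU Cε θ ω (n + t)).2 - (terLU Cε θ ω (n + t)).1))
        (ω (n + t)).1 (ω (n + t)).2 =
      regSum Cε θ T (terLU Cε θ ω n) fun t => ω (n + t) := by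
  induction T generalizing n with
  | zero => rfl
  | succ T ih =>
    have h := ih (n + 1)
    have hs : ∀ t, n + 1 + t = n + (t + 1) := fun t => by omega
    simp only [hs] at h
    rw [Finset.sum_range_succ', h, add_comm]
    rfl

lemma terCumReg_eq_regSum (Cε θ : ℝ) (ω : ℕ → ℝ × ℝ) (T : ℕ) :
    terCumReg Cε θ ω T = regSum Cε θ T (-1, 1) ω := by
  simpa [terCumReg, terLU] using sum_regTer_eq_regSum Cε θ ω T 0

/-- Extension of a finite sequence by zeros. -/
def extendZero {T : ℕ} (v : Fin T → ℝ × ℝ) : ℕ → ℝ × ℝ :=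
  fun t => if h : t < T then v ⟨t, h⟩ else 0

lemma extendZero_cons_zero {T : ℕ} (a : ℝ × ℝ) (v : Fin T → ℝ × ℝ) :
    extendZero (Fin.cons a v : Fin (T + 1) → ℝ × ℝ) 0 = a := by
  simp [extendZero]

lemma extendZero_cons_succ {T : ℕ} (a : ℝ × ℝ) (v : Fin T → ℝ × ℝ) :
    (fun t => extendZero (Fin.cons a v : Fin (T + 1) → ℝ × ℝ) (t + 1)) = extendZero v := by
  funext t
  simp only [extendZero, Nat.add_lt_add_iff_right]
  split_ifs with h
  · exact Fin.cons_succ (α := fun _ => ℝ × ℝ) a v ⟨t, h⟩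
  · rfl

lemma lintegral_pi_succ_le {T : ℕ} (f : (Fin (T + 1) → ℝ × ℝ) → ENNReal) :
    ∫⁻ v, f v ∂(Measure.pi fun _ => stdNormal2) ≤
      ∫⁻ a, ∫⁻ v, f (Fin.cons a v) ∂(Measure.pi fun _ : Fin T => stdNormal2) ∂stdNormal2 := by
  have h := (measurePreserving_piFinSuccAbove (fun _ : Fin (T + 1) => stdNormal2) 0).symm
  rw [← h.lintegral_comp_emb (MeasurableEquiv.measurableEmbedding _)]
  refine (lintegral_prod_le _).trans (le_of_eq ?_)
  simp [MeasurableEquiv.piFinSuccAbove_symm_apply, Fin.insertNthEquiv]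

/-- The expected width decreases by an amount quadratic in the width. The extra summand `f` is
not assumed measurable. -/
lemma lintegral_add_updTer_width_le {θ Cε κ c l u : ℝ} (hC : 0 < Cε) (hc : 0 ≤ c)
    (hκ0 : 0 ≤ κ) (hl : l ≤ θ) (hu : θ ≤ u)
    (hκ : ENNReal.ofReal (κ * (u - l)) ≤ stdNormal2 (shrinkSet Cε ((l + u) / 2) (u - l)))
    (f : ℝ × ℝ → ENNReal) :
    ∫⁻ p, (f p + ENNReal.ofReal
      (c * ((updTer θ Cε l u p.1 p.2).2 - (updTer θ Cε l u p.1 p.2).1))) ∂stdNormal2 ≤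
      ∫⁻ p, f p ∂stdNormal2 + ENNReal.ofReal (c * ((u - l) - κ / 4 * (u - l) ^ 2)) := by
  set w := u - l with hw
  have hw0 : 0 ≤ w := by linarith
  set S := shrinkSet Cε ((l + u) / 2) w with hS
  have hSm : MeasurableSet S := measurableSet_shrinkSet _ _ _
  have hκ1 : κ * w ≤ 1 := by
    rw [← ENNReal.ofReal_le_one]
    exact hκ.trans prob_le_one
  have hcompl : stdNormal2 Sᶜ ≤ ENNReal.ofReal (1 - κ * w) := by
    rw [prob_compl_eq_one_sub hSm, ENNReal.ofReal_sub _ (by positivity), ENNReal.ofReal_one]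
    gcongr
  calc _ ≤ ∫⁻ p, (f p + (Sᶜ.indicator (fun _ => ENNReal.ofReal (c * (w / 4))) p +
          ENNReal.ofReal (c * (3 / 4 * w)))) ∂stdNormal2 := by
        refine lintegral_mono_ae ?_
        filter_upwards [ae_fst_ne_zero] with p hp
        gcongr
        by_cases hpS : p ∈ S
        · rw [indicator_of_notMem (by simpa using hpS), zero_add]
          refine ENNReal.ofReal_le_ofReal (mul_le_mul_of_nonneg_left ?_ hc)
          exact updTer_width_le hC hpS.1.1 hpS.2
        · rw [indicator_of_mem hpS, ← ENNReal.ofReal_add (by positivity) (by positivity)]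
          refine ENNReal.ofReal_le_ofReal ?_
          rw [← mul_add]
          refine mul_le_mul_of_nonneg_left ?_ hc
          have := updTer_bounds (Cε := Cε) p.2 hl hu hp
          linarith
    _ = ∫⁻ p, f p ∂stdNormal2 + (ENNReal.ofReal (c * (w / 4)) * stdNormal2 Sᶜ +
          ENNReal.ofReal (c * (3 / 4 * w))) := by
        have hind : Measurable (Sᶜ.indicator fun _ => ENNReal.ofReal (c * (w / 4))) :=
          measurable_const.indicator hSm.compl
        have hsum : Measurable fun p => Sᶜ.indicator (fun _ => ENNReal.ofReal (c * (w / 4))) p +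
            ENNReal.ofReal (c * (3 / 4 * w)) := hind.add measurable_const
        rw [lintegral_add_right _ hsum,
          lintegral_add_right _ measurable_const, lintegral_indicator_const hSm.compl]
        simp
    _ ≤ ∫⁻ p, f p ∂stdNormal2 + (ENNReal.ofReal (c * (w / 4)) * ENNReal.ofReal (1 - κ * w) +
          ENNReal.ofReal (c * (3 / 4 * w))) := by
        gcongr
    _ = ∫⁻ p, f p ∂stdNormal2 + ENNReal.ofReal (c * (w - κ / 4 * w ^ 2)) := by
        rw [← ENNReal.ofReal_mul (by positivity), ← ENNReal.ofReal_add _ (by positivity)]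
        · congr 2
          ring
        · have : 0 ≤ 1 - κ * w := by linarith
          positivity

/-- The width of the current interval, suitably scaled, dominates the expected future regret. -/
lemma exists_lintegral_regSum_le {Cε : ℝ} (hC : 0 < Cε) :
    ∃ c : ℝ, 0 < c ∧ ∀ (T : ℕ) (θ l u : ℝ), -1 ≤ l → l ≤ θ → θ ≤ u → u ≤ 1 →
      ∫⁻ v, ENNReal.ofReal (regSum Cε θ T (l, u) (extendZero v))
        ∂(Measure.pi fun _ : Fin T => stdNormal2) ≤ ENNReal.ofReal (c * (u - l)) := by
  obtain ⟨κ, hκ0, hκ⟩ := exists_le_measure_shrinkSet hC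
  obtain ⟨K, hK0, hK⟩ := exists_lintegral_regTer_le hC
  refine ⟨4 * K / κ, by positivity, fun T => ?_⟩
  set c := 4 * K / κ with hc
  have hc0 : 0 < c := by positivity
  induction T with
  | zero => intros; simp [regSum]
  | succ T ih =>
    intro θ l u hl hlθ hθu hu
    have hm : |(l + u) / 2| ≤ 1 := abs_le.2 ⟨by linarith, by linarith⟩
    have hκlu := hκ ((l + u) / 2) (u - l) hm (by linarith) (by linarith)
    have hκ1 : κ * (u - l) ≤ 1 := by
      rw [← ENNReal.ofReal_le_one]
      exact hκlu.trans prob_le_one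
    have hreg := hK θ ((l + u) / 2) (u - l) (by linarith) (by linarith) hm
      (abs_le.2 ⟨by linarith, by linarith⟩) (abs_le.2 ⟨by linarith, by linarith⟩)
    have hdecr : K * (u - l) ^ 2 = c * (κ / 4 * (u - l) ^ 2) := by
      rw [hc]; field_simp
    have hrest : 0 ≤ u - l - κ / 4 * (u - l) ^ 2 := by nlinarith
    refine (lintegral_pi_succ_le _).trans ?_
    simp only [regSum, extendZero_cons_zero, extendZero_cons_succ]
    calc _ ≤ ∫⁻ a, (ENNReal.ofReal (regTer θ ((l + u) / 2) (Cε * (u - l)) a.1 a.2) +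
            ENNReal.ofReal (c * ((updTer θ Cε l u a.1 a.2).2 - (updTer θ Cε l u a.1 a.2).1)))
            ∂stdNormal2 := by
          refine lintegral_mono_ae ?_
          filter_upwards [ae_fst_ne_zero] with a ha
          obtain ⟨h1, h2, h3, h4⟩ := updTer_bounds (Cε := Cε) a.2 hlθ hθu ha
          simp only [ENNReal.ofReal_add (regTer_nonneg _ _ _ _ _) (regSum_nonneg _ _ _ _ _)]
          rw [lintegral_add_left measurable_const]
          simp only [lintegral_const, measure_univ, mul_one]
          gcongr
          exact ih θ _ _ (hl.trans h1) h2 h3 (h4.trans hu)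
      _ ≤ ∫⁻ a, ENNReal.ofReal (regTer θ ((l + u) / 2) (Cε * (u - l)) a.1 a.2) ∂stdNormal2 +
            ENNReal.ofReal (c * ((u - l) - κ / 4 * (u - l) ^ 2)) :=
          lintegral_add_updTer_width_le hC hc0.le hκ0.le hlθ hθu hκlu _
      _ ≤ ENNReal.ofReal (K * (u - l) ^ 2) +
            ENNReal.ofReal (c * ((u - l) - κ / 4 * (u - l) ^ 2)) := by
          gcongr
      _ = ENNReal.ofReal (c * (u - l)) := by
          rw [← ENNReal.ofReal_add (by positivity) (by positivity), hdecr]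
          congr 1
          ring

lemma ae_mem_Icc_uniformState : ∀ᵐ θ ∂uniformState, θ ∈ Icc (-1 : ℝ) 1 :=
  Measure.ae_smul_measure (ae_restrict_mem measurableSet_Icc) _

lemma uniformState_univ : uniformState univ = 1 := by
  simp only [uniformState, Measure.smul_apply, Measure.restrict_apply MeasurableSet.univ,
    univ_inter, Real.volume_Icc, smul_eq_mul]
  norm_num
  exact ENNReal.inv_mul_cancel (by simp) (by simp)

/-- **Regret bound of the ternary policy.** For every `Cε > 0` there is a constant
`C_ter > 0` depending only on `Cε` such that, with `ε_t = Cε * w_t` in every round,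
the expected cumulative regret is at most `C_ter` for every horizon `T`. -/
theorem ternary_cumulative_regret_upper_bound :
    ∀ Cε : ℝ, 0 < Cε →
      ∃ Cter : ℝ, 0 < Cter ∧
        ∀ T : ℕ,
          ∫ p : ℝ × (Fin T → ℝ × ℝ),
            terCumReg Cε p.1 (fun t => if h : t < T then p.2 ⟨t, h⟩ else 0) T
            ∂(uniformState.prod (Measure.pi fun _ : Fin T => stdNormal2)) ≤ Cter := by
  intro Cε hC
  obtain ⟨c, hc0, hc⟩ := exists_lintegral_regSum_le hC
  refine ⟨c * 2, by positivity, fun T => ?_⟩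
  refine (Real.le_norm_self _).trans ((norm_integral_le_lintegral_norm _).trans ?_)
  refine ENNReal.toReal_le_of_le_ofReal (by positivity) ((lintegral_prod_le _).trans ?_)
  calc _ ≤ ∫⁻ _, ENNReal.ofReal (c * 2) ∂uniformState := by
        refine lintegral_mono_ae ?_
        filter_upwards [ae_mem_Icc_uniformState] with θ hθ
        simp only [terCumReg_eq_regSum, Real.norm_eq_abs, abs_of_nonneg (regSum_nonneg _ _ _ _ _)]
        refine (hc T θ (-1) 1 le_rfl hθ.1 hθ.2 le_rfl).trans (le_of_eq ?_)
        norm_num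
    _ = ENNReal.ofReal (c * 2) := by
        rw [lintegral_const, uniformState_univ, mul_one]

end
end

section
/- Equivalence of the myopic and straightforward policies under narrow confidence intervals: for every δ ∈ (0, 1) and every interval [l, u] ⊆ [-1, 1] whose width w = u - l satisfies w < δ² / (4·√(π·log(1/δ))), the probability over x ~ N(0,1) that the straightforward threshold ρ = -x·m is a maximizer of ρ ↦ V(ρ; x, l, u) (i.e., V(ρ; x, l, u) ≤ V(-x·m; x, l, u) for all ρ ∈ ℝ) is at least 1 - δ, where m = (l+u)/2. -/
open MeasureTheory ProbabilityTheory Set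

noncomputable section

/-- Uniform probability measure on `[l, u]`. -/
def uniformIcc (l u : ℝ) : Measure ℝ :=
  (ENNReal.ofReal (u - l))⁻¹ • volume.restrict (Set.Icc l u)

/-- Myopic value `V(ρ; x, l, u)` of the binary threshold policy with threshold `ρ`:
the expected payoff of a user whose state `θ̃` is uniform on `[l, u]`, when the
message is `a = 1` iff `z > ρ`, the posterior mean is `E[z' | z' > ρ]` (resp.
`E[z' | z' < ρ]`), and the user picks arm 1 iff `x * θ̃ + Z > 0`. -/
def myopicV (ρ x l u : ℝ) : ℝ :=
  ∫ p : ℝ × ℝ,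
    (if 0 < x * p.1 + (if ρ < p.2 then truncMeanAbove ρ else truncMeanBelow ρ)
     then x * p.1 + p.2 else 0)
    ∂((uniformIcc l u).prod stdNormal)

lemma stdPdf_eq_gaussianPDFReal : stdPdf = gaussianPDFReal 0 1 := by
  ext z
  simp [stdPdf, gaussianPDFReal_def, div_eq_inv_mul]

lemma integral_stdNormal (f : ℝ → ℝ) : ∫ z, f z ∂stdNormal = ∫ z, f z * stdPdf z := by
  rw [stdNormal, integral_gaussianReal_eq_integral_smul one_ne_zero]
  simp [stdPdf_eq_gaussianPDFReal, mul_comm]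

lemma setIntegral_stdNormal (f : ℝ → ℝ) {s : Set ℝ} (hs : MeasurableSet s) :
    ∫ z in s, f z ∂stdNormal = ∫ z in s, f z * stdPdf z := by
  rw [← integral_indicator hs, integral_stdNormal, ← integral_indicator hs]
  congr 1 with z
  by_cases hz : z ∈ s <;> simp [hz]

lemma stdNormal_real_eq {s : Set ℝ} (hs : MeasurableSet s) :
    stdNormal.real s = ∫ z in s, stdPdf z := by
  simpa using setIntegral_stdNormal (fun _ ↦ 1) hs

lemma integrable_id_stdNormal : Integrable (fun z : ℝ ↦ z) stdNormal :=
  (memLp_id_gaussianReal (μ := 0) (v := 1) 1).integrable le_rfl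

lemma integral_id_stdNormal : ∫ z, z ∂stdNormal = 0 := integral_id_gaussianReal

lemma stdNormal_real_pos_of_isOpen {s : Set ℝ} (hs : IsOpen s) (hne : s.Nonempty) :
    0 < stdNormal.real s := by
  refine ENNReal.toReal_pos (fun h ↦ ?_) (measure_ne_top _ _)
  exact (hs.measure_pos volume hne).ne' (gaussianReal_absolutelyContinuous' 0 one_ne_zero h)

lemma setIntegral_id_stdNormal_Iic (ρ : ℝ) :
    ∫ z in Iic ρ, z ∂stdNormal = -∫ z in Ioi ρ, z ∂stdNormal := by
  have h := integral_add_compl (measurableSet_Iic (a := ρ)) integrable_id_stdNormal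
  rw [compl_Iic, integral_id_stdNormal] at h
  linarith

lemma setIntegral_id_stdNormal_Ioi_nonneg (ρ : ℝ) : 0 ≤ ∫ z in Ioi ρ, z ∂stdNormal := by
  rcases le_total 0 ρ with h | h
  · exact setIntegral_nonneg measurableSet_Ioi fun z hz ↦ h.trans (le_of_lt hz)
  · have := setIntegral_nonpos (μ := stdNormal) (f := fun z ↦ z) (measurableSet_Iic (a := ρ))
      fun z hz ↦ le_trans hz h
    rw [setIntegral_id_stdNormal_Iic] at this
    linarith

lemma truncMeanAbove_eq (ρ : ℝ) :
    truncMeanAbove ρ = (∫ z in Ioi ρ, z ∂stdNormal) / stdNormal.real (Ioi ρ) := by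
  rw [truncMeanAbove, stdNormal_real_eq measurableSet_Ioi,
    setIntegral_stdNormal _ measurableSet_Ioi]

lemma stdNormal_real_Iic (ρ : ℝ) : stdNormal.real (Iic ρ) = 1 - stdNormal.real (Ioi ρ) := by
  rw [← compl_Ioi, probReal_compl_eq_one_sub measurableSet_Ioi]

lemma stdNormal_real_Ioi_lt_one (ρ : ℝ) : stdNormal.real (Ioi ρ) < 1 := by
  have h := stdNormal_real_pos_of_isOpen isOpen_Iio (nonempty_Iio (a := ρ))
  have h2 : stdNormal.real (Iio ρ) ≤ stdNormal.real (Iic ρ) := measureReal_mono Iio_subset_Iic_self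
  rw [stdNormal_real_Iic] at h2
  linarith

lemma truncMeanBelow_eq (ρ : ℝ) :
    truncMeanBelow ρ = -(∫ z in Ioi ρ, z ∂stdNormal) / (1 - stdNormal.real (Ioi ρ)) := by
  rw [truncMeanBelow, ← integral_Iic_eq_integral_Iio, ← integral_Iic_eq_integral_Iio,
    ← stdNormal_real_Iic, stdNormal_real_eq measurableSet_Iic, ← setIntegral_id_stdNormal_Iic,
    setIntegral_stdNormal _ measurableSet_Iic]

lemma setIntegral_const_add_stdNormal (t : ℝ) (s : Set ℝ) :
    ∫ z in s, (t + z) ∂stdNormal = t * stdNormal.real s + ∫ z in s, z ∂stdNormal := by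
  rw [integral_add (integrable_const t) integrable_id_stdNormal.integrableOn]
  simp [mul_comm]

/-- Conditional on the state, the payoff of a threshold policy is the best of never acting,
always acting, and acting exactly when the signal exceeds the threshold. -/
lemma integral_threshold_payoff (ρ t : ℝ) :
    ∫ z, (if 0 < t + (if ρ < z then truncMeanAbove ρ else truncMeanBelow ρ) then t + z else 0)
      ∂stdNormal =
    max 0 (max t (t * stdNormal.real (Ioi ρ) + ∫ z in Ioi ρ, z ∂stdNormal)) := by
  have hp := stdNormal_real_pos_of_isOpen isOpen_Ioi (nonempty_Ioi (a := ρ))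
  have hp1 := stdNormal_real_Ioi_lt_one ρ
  have hq := setIntegral_id_stdNormal_Ioi_nonneg ρ
  have h_integrable : Integrable (fun z ↦
      if 0 < t + (if ρ < z then truncMeanAbove ρ else truncMeanBelow ρ) then t + z else 0)
      stdNormal := by
    refine Integrable.mono' (((integrable_const t).add integrable_id_stdNormal).abs) ?_ ?_
    · refine (Measurable.ite ?_ (by fun_prop) (by fun_prop)).aestronglyMeasurable
      refine measurableSet_lt (by fun_prop) (measurable_const.add ?_)
      exact Measurable.ite measurableSet_Ioi (by fun_prop) (by fun_prop)
    · refine Filter.Eventually.of_forall fun z ↦ ?_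
      split_ifs <;> simp
  rw [← integral_add_compl (measurableSet_Ioi (a := ρ)) h_integrable, compl_Ioi]
  have h1 : ∫ z in Ioi ρ, (if 0 < t + (if ρ < z then truncMeanAbove ρ else truncMeanBelow ρ)
      then t + z else 0) ∂stdNormal =
      if 0 < t + truncMeanAbove ρ then
        t * stdNormal.real (Ioi ρ) + ∫ z in Ioi ρ, z ∂stdNormal else 0 := by
    rw [← setIntegral_const_add_stdNormal]
    rw [setIntegral_congr_fun (g := fun z ↦ if 0 < t + truncMeanAbove ρ then t + z else 0)
      measurableSet_Ioi (fun z hz ↦ by simp [mem_Ioi.mp hz])]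
    split_ifs <;> simp
  have h2 : ∫ z in Iic ρ, (if 0 < t + (if ρ < z then truncMeanAbove ρ else truncMeanBelow ρ)
      then t + z else 0) ∂stdNormal =
      if 0 < t + truncMeanBelow ρ then
        t * (1 - stdNormal.real (Ioi ρ)) - ∫ z in Ioi ρ, z ∂stdNormal else 0 := by
    rw [sub_eq_add_neg, ← setIntegral_id_stdNormal_Iic, ← stdNormal_real_Iic,
      ← setIntegral_const_add_stdNormal]
    rw [setIntegral_congr_fun (g := fun z ↦ if 0 < t + truncMeanBelow ρ then t + z else 0)
      measurableSet_Iic (fun z hz ↦ by simp [not_lt.mpr (mem_Iic.mp hz)])]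
    split_ifs <;> simp
  rw [h1, h2, truncMeanAbove_eq, truncMeanBelow_eq]
  generalize stdNormal.real (Ioi ρ) = p at *
  generalize ∫ z in Ioi ρ, z ∂stdNormal = q at *
  have hp2 : 0 < 1 - p := by linarith
  have e1 : t + q / p = (t * p + q) / p := by field_simp
  have e2 : t + -q / (1 - p) = (t * (1 - p) - q) / (1 - p) := by field_simp; ring
  rw [e1, e2]
  simp only [div_pos_iff_of_pos_right hp, div_pos_iff_of_pos_right hp2]
  split_ifs with ha hb hb
  · have : 0 < t := by nlinarith
    rw [max_eq_left (b := t * p + q) (by linarith), max_eq_right this.le]; ring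
  · rw [max_eq_right (b := t * p + q) (by linarith), max_eq_right ha.le]; ring
  · have : 0 < t := by nlinarith
    nlinarith
  · have : t ≤ 0 := by nlinarith
    rw [max_eq_left (max_le this (by linarith))]; ring

lemma isFiniteMeasure_uniformIcc {l u : ℝ} (hlu : l < u) : IsFiniteMeasure (uniformIcc l u) := by
  refine ⟨?_⟩
  simp only [uniformIcc, Measure.smul_apply, smul_eq_mul]
  refine ENNReal.mul_lt_top ?_ (measure_lt_top _ _)
  simp [hlu]

lemma integrable_threshold_payoff (ρ x : ℝ) {l u : ℝ} (hlu : l < u) :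
    Integrable (fun p : ℝ × ℝ ↦
      if 0 < x * p.1 + (if ρ < p.2 then truncMeanAbove ρ else truncMeanBelow ρ)
      then x * p.1 + p.2 else 0) ((uniformIcc l u).prod stdNormal) := by
  have := isFiniteMeasure_uniformIcc hlu
  have hid : Integrable (fun θ : ℝ ↦ θ) (uniformIcc l u) := by
    refine Integrable.smul_measure ?_ (by simp [hlu])
    exact continuous_id.integrableOn_Icc
  refine Integrable.mono' (((hid.comp_fst stdNormal).const_mul x).add
    (integrable_id_stdNormal.comp_snd (uniformIcc l u))).abs ?_ ?_
  · refine (Measurable.ite ?_ (by fun_prop) (by fun_prop)).aestronglyMeasurable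
    refine measurableSet_lt (by fun_prop) ((measurable_fst.const_mul x).add ?_)
    exact Measurable.ite (measurableSet_lt measurable_const measurable_snd)
      (by fun_prop) (by fun_prop)
  · refine Filter.Eventually.of_forall fun z ↦ ?_
    split_ifs <;> simp

lemma integral_uniformIcc (f : ℝ → ℝ) {l u : ℝ} (hlu : l < u) :
    ∫ θ, f θ ∂uniformIcc l u = (u - l)⁻¹ * ∫ θ in l..u, f θ := by
  rw [uniformIcc, integral_smul_measure, intervalIntegral.integral_of_le hlu.le,
    integral_Icc_eq_integral_Ioc, ENNReal.toReal_inv,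
    ENNReal.toReal_ofReal (sub_nonneg.mpr hlu.le), smul_eq_mul]

lemma myopicV_eq (ρ x : ℝ) {l u : ℝ} (hlu : l < u) :
    myopicV ρ x l u = (u - l)⁻¹ * ∫ θ in l..u,
      max 0 (max (x * θ) (x * θ * stdNormal.real (Ioi ρ) + ∫ z in Ioi ρ, z ∂stdNormal)) := by
  have := isFiniteMeasure_uniformIcc hlu
  rw [myopicV, integral_prod _ (integrable_threshold_payoff ρ x hlu)]
  simp only [integral_threshold_payoff]
  rw [integral_uniformIcc _ hlu]

lemma myopicV_of_eq (ρ x l : ℝ) : myopicV ρ x l l = 0 := by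
  simp [myopicV, uniformIcc]

/-- Expected payoff `E[(t + z)⁺]` in state `t` of a user who observes the signal. -/
def informedValue (t : ℝ) : ℝ := ∫ z, max (t + z) 0 ∂stdNormal

lemma integrable_max_const_add (t : ℝ) : Integrable (fun z ↦ max (t + z) 0) stdNormal :=
  ((integrable_const t).add integrable_id_stdNormal).sup (integrable_const 0)

lemma threshold_value_le_informedValue (ρ t : ℝ) :
    t * stdNormal.real (Ioi ρ) + ∫ z in Ioi ρ, z ∂stdNormal ≤ informedValue t := by
  rw [← setIntegral_const_add_stdNormal, ← integral_indicator measurableSet_Ioi]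
  refine integral_mono (((integrable_const t).add integrable_id_stdNormal).indicator
    measurableSet_Ioi) (integrable_max_const_add t) fun z ↦ ?_
  by_cases hz : z ∈ Ioi ρ <;> simp [hz]

lemma threshold_value_eq_informedValue (t : ℝ) :
    t * stdNormal.real (Ioi (-t)) + ∫ z in Ioi (-t), z ∂stdNormal = informedValue t := by
  rw [← setIntegral_const_add_stdNormal, ← integral_indicator measurableSet_Ioi]
  refine integral_congr_ae (Filter.Eventually.of_forall fun z ↦ ?_)
  by_cases hz : z ∈ Ioi (-t)
  · have : -t < z := hz
    simp only [hz, indicator_of_mem]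
    rw [max_eq_left (by linarith)]
  · have : ¬ -t < z := hz
    simp only [hz, not_false_eq_true, indicator_of_notMem]
    rw [max_eq_right (by linarith)]

lemma informedValue_add_le (t s : ℝ) : informedValue (t + s) ≤ informedValue t + |s| := by
  have h : informedValue t + |s| = ∫ z, (max (t + z) 0 + |s|) ∂stdNormal := by
    rw [integral_add (integrable_max_const_add t) (integrable_const _)]
    simp [informedValue]
  rw [h]
  refine integral_mono (integrable_max_const_add _)
    ((integrable_max_const_add t).add (integrable_const _)) fun z ↦ ?_
  have := le_abs_self s
  have := le_max_left (t + z) 0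
  have := le_max_right (t + z) 0
  exact max_le (by linarith) (by positivity)

lemma informedValue_neg (t : ℝ) : informedValue (-t) = informedValue t - t := by
  have h : informedValue (-t) = ∫ z, max (-t + -z) 0 ∂stdNormal := by
    have hmap : stdNormal.map (fun z ↦ -z) = stdNormal := by
      simpa [stdNormal] using gaussianReal_map_neg (μ := 0) (v := 1)
    conv_lhs => rw [informedValue, ← hmap]
    exact integral_map (by fun_prop) (by fun_prop)
  have h2 : informedValue t - t = ∫ z, (max (t + z) 0 - (t + z)) ∂stdNormal := by
    have hsum := integral_add (integrable_const (μ := stdNormal) t) integrable_id_stdNormal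
    rw [integral_id_stdNormal] at hsum
    have hsub := integral_sub (integrable_max_const_add t)
      ((integrable_const t).add integrable_id_stdNormal)
    simp only [Pi.add_apply] at hsub
    rw [hsub, hsum]
    simp [informedValue]
  rw [h, h2]
  congr 1 with z
  rcases le_total (t + z) 0 with hz | hz
  · rw [max_eq_right hz, max_eq_left (by linarith)]; ring
  · rw [max_eq_left hz, max_eq_right (by linarith)]; ring

lemma integral_Ioi_mul_exp_neg_sq : ∫ y in Ioi (0 : ℝ), y * Real.exp (-y ^ 2) = 1 / 2 := by
  have h := integral_rpow_mul_exp_neg_rpow (p := 2) (q := 1) (by norm_num) (by norm_num)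
  norm_num at h
  simpa using h

lemma le_informedValue (t : ℝ) :
    Real.exp (-t ^ 2) / (2 * Real.sqrt (2 * Real.pi)) ≤ informedValue t := by
  have h_integrable : Integrable (fun z ↦ max (t + z) 0 * stdPdf z) := by
    have h := integrable_max_const_add t
    rw [stdNormal, gaussianReal_of_var_ne_zero 0 one_ne_zero,
      integrable_withDensity_iff_integrable_smul' (measurable_gaussianPDF 0 1)
        (Filter.Eventually.of_forall fun _ ↦ gaussianPDF_lt_top)] at h
    refine h.congr (Filter.Eventually.of_forall fun z ↦ ?_)
    simp [stdPdf_eq_gaussianPDFReal, toReal_gaussianPDF, mul_comm]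
  have hshift : informedValue t = ∫ y, max y 0 * stdPdf (y - t) := by
    rw [informedValue, integral_stdNormal,
      ← integral_sub_right_eq_self (fun z ↦ max (t + z) 0 * stdPdf z) t]
    simp
  have h_shifted : Integrable (fun y ↦ max y 0 * stdPdf (y - t)) := by
    simpa using h_integrable.comp_sub_right t
  rw [hshift]
  calc Real.exp (-t ^ 2) / (2 * Real.sqrt (2 * Real.pi))
      = ∫ y in Ioi (0 : ℝ), Real.exp (-t ^ 2) / Real.sqrt (2 * Real.pi) *
          (y * Real.exp (-y ^ 2)) := by
        rw [integral_const_mul, integral_Ioi_mul_exp_neg_sq]; field_simp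
    _ ≤ ∫ y in Ioi (0 : ℝ), max y 0 * stdPdf (y - t) := by
        refine setIntegral_mono_on ?_ h_shifted.integrableOn measurableSet_Ioi fun y hy ↦ ?_
        · have := integrable_mul_exp_neg_mul_sq (b := 1) one_pos
          simp only [neg_mul, one_mul] at this
          exact (this.const_mul _).integrableOn
        · have hy : 0 < y := hy
          rw [max_eq_left hy.le, stdPdf]
          have : Real.exp (-t ^ 2) * Real.exp (-y ^ 2) ≤ Real.exp (-(y - t) ^ 2 / 2) := by
            rw [← Real.exp_add]
            exact Real.exp_le_exp.mpr (by nlinarith [sq_nonneg (y + t)])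
          calc _ = y * (Real.exp (-t ^ 2) * Real.exp (-y ^ 2) / Real.sqrt (2 * Real.pi)) := by ring
            _ ≤ _ := by gcongr
    _ ≤ ∫ y, max y 0 * stdPdf (y - t) :=
        setIntegral_le_integral h_shifted (Filter.Eventually.of_forall fun y ↦
          mul_nonneg (le_max_right _ _) (stdPdf_pos _).le)

/-- Payoffs of a threshold policy in two states symmetric about `μ` average to at most the informed
value at `μ`, as long as the two states are close enough. -/
lemma threshold_payoff_pair_le (ρ μ s : ℝ) (h1 : 2 * |s| ≤ informedValue μ)
    (h2 : 2 * |s| ≤ informedValue μ - μ) :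
    max 0 (max (μ + s) ((μ + s) * stdNormal.real (Ioi ρ) + ∫ z in Ioi ρ, z ∂stdNormal)) +
      max 0 (max (μ - s) ((μ - s) * stdNormal.real (Ioi ρ) + ∫ z in Ioi ρ, z ∂stdNormal)) ≤
    2 * informedValue μ := by
  have ha := threshold_value_le_informedValue ρ (μ + s)
  have hb := threshold_value_le_informedValue ρ (μ - s)
  have hc := threshold_value_le_informedValue ρ μ
  have hs1 := informedValue_add_le μ s
  have hs2 := informedValue_add_le μ (-s)
  rw [abs_neg, ← sub_eq_add_neg] at hs2
  have := le_abs_self s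
  have := neg_le_abs s
  have := abs_nonneg s
  simp only [← max_add_add_right, ← max_add_add_left, max_le_iff]
  refine ⟨⟨?_, ?_, ?_⟩, ⟨?_, ?_, ?_⟩, ?_, ?_, ?_⟩ <;> linarith

lemma myopicV_le_informedValue (ρ x : ℝ) {l u : ℝ} (hlu : l < u)
    (h1 : |x| * (u - l) ≤ informedValue (x * ((l + u) / 2)))
    (h2 : |x| * (u - l) ≤ informedValue (x * ((l + u) / 2)) - x * ((l + u) / 2)) :
    myopicV ρ x l u ≤ informedValue (x * ((l + u) / 2)) := by
  rw [myopicV_eq ρ x hlu]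
  set μ := x * ((l + u) / 2) with hμ
  set f : ℝ → ℝ := fun θ ↦
    max 0 (max (x * θ) (x * θ * stdNormal.real (Ioi ρ) + ∫ z in Ioi ρ, z ∂stdNormal))
  have hcont : Continuous f := by fun_prop
  have hrefl : ∫ θ in l..u, f (l + u - θ) = ∫ θ in l..u, f θ := by
    rw [intervalIntegral.integral_comp_sub_left]; simp
  have hpair : ∫ θ in l..u, (f θ + f (l + u - θ)) ≤ ∫ _ in l..u, 2 * informedValue μ := by
    refine intervalIntegral.integral_mono_on hlu.le
      (Continuous.intervalIntegrable (by fun_prop) _ _) (by simp) fun θ hθ ↦ ?_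
    have hs : 2 * |x * (θ - (l + u) / 2)| ≤ |x| * (u - l) := by
      have : |θ - (l + u) / 2| ≤ (u - l) / 2 := abs_le.mpr ⟨by linarith [hθ.1], by linarith [hθ.2]⟩
      rw [abs_mul]
      nlinarith [abs_nonneg x]
    have := threshold_payoff_pair_le ρ μ (x * (θ - (l + u) / 2)) (hs.trans h1) (hs.trans h2)
    have e1 : μ + x * (θ - (l + u) / 2) = x * θ := by rw [hμ]; ring
    have e2 : μ - x * (θ - (l + u) / 2) = x * (l + u - θ) := by rw [hμ]; ring
    rwa [e1, e2] at this
  rw [intervalIntegral.integral_add (hcont.intervalIntegrable _ _)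
    (Continuous.intervalIntegrable (by fun_prop) _ _), hrefl,
    intervalIntegral.integral_const, smul_eq_mul] at hpair
  rw [inv_mul_le_iff₀ (by linarith)]
  linarith

lemma informedValue_le_myopicV (x : ℝ) {l u : ℝ} (hlu : l < u) :
    informedValue (x * ((l + u) / 2)) ≤ myopicV (-(x * ((l + u) / 2))) x l u := by
  rw [myopicV_eq _ x hlu, le_inv_mul_iff₀ (by linarith), ← threshold_value_eq_informedValue]
  generalize stdNormal.real (Ioi (-(x * ((l + u) / 2)))) = p
  generalize ∫ z in Ioi (-(x * ((l + u) / 2))), z ∂stdNormal = q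
  have hlin : ∫ θ in l..u, (x * θ * p + q) = (u - l) * (x * ((l + u) / 2) * p + q) := by
    rw [intervalIntegral.integral_add (Continuous.intervalIntegrable (by fun_prop) _ _) (by simp),
      intervalIntegral.integral_mul_const, intervalIntegral.integral_const_mul, integral_id,
      intervalIntegral.integral_const, smul_eq_mul]
    ring
  rw [← hlin]
  refine intervalIntegral.integral_mono_on hlu.le
    (Continuous.intervalIntegrable (by fun_prop) _ _)
    (Continuous.intervalIntegrable (by fun_prop) _ _) fun θ _ ↦ ?_
  exact (le_max_right _ _).trans (le_max_right _ _)

lemma stdNormal_real_Ioi_zero : stdNormal.real (Ioi 0) = 1 / 2 := by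
  have h := integral_gaussian_Ioi (1 / 2)
  have e : ∀ z : ℝ, stdPdf z = (Real.sqrt (2 * Real.pi))⁻¹ * Real.exp (-(1 / 2) * z ^ 2) := by
    intro z
    rw [stdPdf, div_eq_inv_mul]
    congr 2
    ring
  rw [stdNormal_real_eq measurableSet_Ioi]
  simp_rw [e]
  rw [integral_const_mul, h, show Real.pi / (1 / 2) = 2 * Real.pi by ring]
  have : 0 < Real.sqrt (2 * Real.pi) := by positivity
  field_simp

lemma stdNormal_real_Ioi_le {c : ℝ} (hc : 0 ≤ c) :
    stdNormal.real (Ioi c) ≤ Real.exp (-c ^ 2 / 2) / 2 := by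
  have hshift : stdNormal.real (Ioi c) = ∫ y in Ioi (0 : ℝ), stdPdf (y + c) := by
    rw [stdNormal_real_eq measurableSet_Ioi, ← integral_indicator measurableSet_Ioi,
      ← integral_add_right_eq_self _ c, ← integral_indicator measurableSet_Ioi]
    congr 1 with y
    simp [indicator_apply]
  calc stdNormal.real (Ioi c) = ∫ y in Ioi (0 : ℝ), stdPdf (y + c) := hshift
    _ ≤ ∫ y in Ioi (0 : ℝ), Real.exp (-c ^ 2 / 2) * stdPdf y := by
        refine setIntegral_mono_on (integrable_stdPdf.comp_add_right c).integrableOn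
          (integrable_stdPdf.const_mul _).integrableOn measurableSet_Ioi fun y hy ↦ ?_
        have hy : 0 < y := hy
        rw [stdPdf, stdPdf, ← mul_div_assoc, ← Real.exp_add]
        gcongr
        nlinarith
    _ = Real.exp (-c ^ 2 / 2) / 2 := by
        rw [integral_const_mul, ← stdNormal_real_eq measurableSet_Ioi, stdNormal_real_Ioi_zero]
        ring

lemma le_stdNormal_Icc {c : ℝ} (hc : 0 ≤ c) :
    ENNReal.ofReal (1 - Real.exp (-c ^ 2 / 2)) ≤ stdNormal (Icc (-c) c) := by
  rw [← ofReal_measureReal]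
  refine ENNReal.ofReal_le_ofReal ?_
  have hsymm : stdNormal.real (Iio (-c)) = stdNormal.real (Ioi c) := by
    have hmap : stdNormal.map (fun z ↦ -z) = stdNormal := by
      simpa [stdNormal] using gaussianReal_map_neg (μ := 0) (v := 1)
    conv_lhs => rw [← hmap]
    rw [map_measureReal_apply (by fun_prop) measurableSet_Iio]
    congr 1 with z
    simp
  have hcover : (Icc (-c) c)ᶜ = Iio (-c) ∪ Ioi c := by
    ext z
    simp only [mem_compl_iff, mem_Icc, not_and_or, not_le, mem_union, mem_Iio, mem_Ioi]
  have h1 := probReal_compl_eq_one_sub (μ := stdNormal) (measurableSet_Icc (a := -c) (b := c))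
  have h2 := measureReal_union_le (μ := stdNormal) (Iio (-c)) (Ioi c)
  have h3 := stdNormal_real_Ioi_le hc
  rw [← hcover, hsymm, h1] at h2
  linarith

/-- **Equivalence of the myopic and straightforward policies under narrow
confidence intervals.** For every `δ ∈ (0,1)` and every `[l, u] ⊆ [-1, 1]` with
width `w = u - l < δ² / (4 √(π log (1/δ)))`, with probability at least `1 - δ` over
`x ~ N(0,1)`, the straightforward threshold `ρ = -x·m` maximizes `ρ ↦ V(ρ; x, l, u)`. -/
theorem myopic_equals_straightforward_for_narrow_intervals :
    ∀ δ : ℝ, 0 < δ → δ < 1 →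
      ∀ l u : ℝ, -1 ≤ l → l ≤ u → u ≤ 1 →
        u - l < δ ^ 2 / (4 * Real.sqrt (Real.pi * Real.log (1 / δ))) →
        ENNReal.ofReal (1 - δ) ≤
          stdNormal
            {x : ℝ | ∀ ρ : ℝ, myopicV ρ x l u ≤ myopicV (-(x * ((l + u) / 2))) x l u} := by
  intro δ hδ0 hδ1 l u hl hlu hu hw
  rcases hlu.eq_or_lt with rfl | hlu
  · simp only [myopicV_of_eq, le_refl, implies_true, Set.ofPred_true, measure_univ]
    exact ENNReal.ofReal_le_one.mpr (by linarith)
  set L := Real.log (1 / δ) with hL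
  have hLpos : 0 < L := Real.log_pos ((one_lt_div hδ0).mpr hδ1)
  have hexpL : Real.exp (-L) = δ := by
    rw [hL, one_div, Real.log_inv, neg_neg, Real.exp_log hδ0]
  have hc2 : Real.sqrt (2 * L) ^ 2 = 2 * L := Real.sq_sqrt (by positivity)
  have hprob := le_stdNormal_Icc (Real.sqrt_nonneg (2 * L))
  rw [hc2, show -(2 * L) / 2 = -L by ring, hexpL] at hprob
  refine hprob.trans (measure_mono fun x hx ρ ↦ ?_)
  have hx : |x| ≤ Real.sqrt (2 * L) := abs_le.mpr hx
  have hsmall : |x| * (u - l) ≤ δ ^ 2 / (2 * Real.sqrt (2 * Real.pi)) := by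
    rw [Real.sqrt_mul Real.pi_pos.le, lt_div_iff₀ (by positivity)] at hw
    rw [Real.sqrt_mul (by norm_num)] at hx ⊢
    rw [le_div_iff₀ (by positivity)]
    have h2 : Real.sqrt 2 ^ 2 = 2 := Real.sq_sqrt (by norm_num)
    have hwpos : 0 < u - l := by linarith
    calc |x| * (u - l) * (2 * (Real.sqrt 2 * Real.sqrt Real.pi))
        ≤ Real.sqrt 2 * Real.sqrt L * (u - l) * (2 * (Real.sqrt 2 * Real.sqrt Real.pi)) := by
          gcongr
      _ = Real.sqrt 2 ^ 2 * (2 * ((u - l) * (Real.sqrt Real.pi * Real.sqrt L))) := by ring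
      _ = (u - l) * (4 * (Real.sqrt Real.pi * Real.sqrt L)) := by rw [h2]; ring
      _ ≤ δ ^ 2 := hw.le
  have hμ : (x * ((l + u) / 2)) ^ 2 ≤ 2 * L := by
    have hx2 : x ^ 2 ≤ 2 * L := by
      rw [← hc2]; exact sq_le_sq' (by linarith [neg_abs_le x]) (by linarith [le_abs_self x])
    have hm : ((l + u) / 2) ^ 2 ≤ 1 := by
      rw [sq_le_one_iff_abs_le_one]
      exact abs_le.mpr ⟨by linarith, by linarith⟩
    rw [mul_pow]
    nlinarith [sq_nonneg x]
  have hexp : δ ^ 2 ≤ Real.exp (-(x * ((l + u) / 2)) ^ 2) := by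
    rw [← hexpL, ← Real.exp_nat_mul]
    refine Real.exp_le_exp.mpr ?_
    push_cast
    linarith
  have hlow : δ ^ 2 / (2 * Real.sqrt (2 * Real.pi)) ≤
      Real.exp (-(x * ((l + u) / 2)) ^ 2) / (2 * Real.sqrt (2 * Real.pi)) := by gcongr
  have h1 := hsmall.trans (hlow.trans (le_informedValue (x * ((l + u) / 2))))
  have h2 := le_informedValue (-(x * ((l + u) / 2)))
  rw [neg_sq, informedValue_neg] at h2
  exact (myopicV_le_informedValue ρ x hlu h1 (hsmall.trans (hlow.trans h2))).trans
    (informedValue_le_myopicV x hlu)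

end
end
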